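/- (Fast-confirmation counting, vanilla version.) Let ε > 0 and M > 0 be real numbers, E a finset of validators with |E| ≤ (1+ε)·M, and W a finite set of votes all of whose validators lie in E. Let b be a block such that the number of distinct validators v with (v, b) ∈ W is at least (3/4+ε)·M, and suppose the number of equivocators in W is strictly less than (1/2)·M. Then for every block c conflicting with b, wt(W, c) < (3/4)·M; consequently, for every blocktree finset T with b ∈ T, every greedy heaviest chain of (T, W) contains b. -/

import Mathlib

/-- `a` is an ancestor of `b` (equivalently, `b` is a descendant of `a`):
`a = parent^[k] b` for some `k ≥ 0`. -/
def Ancestor {B : Type*} (parent : B → B) (a b : B) : Prop :=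
  ∃ k : ℕ, a = parent^[k] b

/-- Blocks `a` and `b` conflict if neither is an ancestor of the other. -/
def Conflicting {B : Type*} (parent : B → B) (a b : B) : Prop :=
  ¬ Ancestor parent a b ∧ ¬ Ancestor parent b a

/-- A finset `T` of blocks is a blocktree finset if it contains the genesis `g`
and is closed under `parent`. -/
def IsBlocktree {B : Type*} (g : B) (parent : B → B) (T : Finset B) : Prop :=
  g ∈ T ∧ ∀ x ∈ T, parent x ∈ T

/-- `c` is a child of `a` in `T`: `c ∈ T`, `c ≠ g`, and `parent c = a`. -/
def IsChild {B : Type*} (g : B) (parent : B → B) (T : Finset B) (a c : B) : Prop :=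
  c ∈ T ∧ c ≠ g ∧ parent c = a

open Classical in
/-- The weight of block `a` w.r.t. the vote set `W`: the number of distinct
validators casting a vote in `W` for a descendant of `a`. -/
noncomputable def wt {B V : Type*} (parent : B → B) (W : Finset (V × B)) (a : B) : ℕ :=
  ((W.filter (fun q => Ancestor parent a q.2)).image Prod.fst).card

/-- `ch 0, ch 1, …, ch k` is a greedy heaviest chain of `(T, W)`:
it starts at the genesis `g`, consists of blocks of `T`, each step goes to a
child of maximal weight, and the endpoint `ch k` has no children in `T`. -/
def IsGreedyChain {B V : Type*} (g : B) (parent : B → B) (T : Finset B)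
    (W : Finset (V × B)) (k : ℕ) (ch : ℕ → B) : Prop :=
  ch 0 = g ∧ (∀ i ≤ k, ch i ∈ T) ∧
  (∀ i < k, IsChild g parent T (ch i) (ch (i + 1)) ∧
      ∀ c', IsChild g parent T (ch i) c' → wt parent W c' ≤ wt parent W (ch (i + 1))) ∧
  ∀ c', ¬ IsChild g parent T (ch k) c'

open Classical in
/-- The equivocators in a vote set `W`: validators with votes in `W` for two
different blocks. -/
noncomputable def Equivocators {B V : Type*} (W : Finset (V × B)) : Finset V :=
  (W.image Prod.fst).filter (fun v => ∃ c c', (v, c) ∈ W ∧ (v, c') ∈ W ∧ c ≠ c')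

lemma IsBlocktree.iterate_mem {B : Type*} {g : B} {parent : B → B} {T : Finset B}
    (hT : IsBlocktree g parent T) {b : B} (hb : b ∈ T) (n : ℕ) : parent^[n] b ∈ T := by
  induction n with
  | zero => exact hb
  | succ n ih => rw [Function.iterate_succ_apply']; exact hT.2 _ ih

/-- A strict ancestor of a block `b` of a blocktree has a child that is an ancestor of `b`. -/
lemma IsBlocktree.exists_isChild_ancestor {B : Type*} {g : B} {parent : B → B} {T : Finset B}
    (hT : IsBlocktree g parent T) (hpg : parent g = g) {a b : B} (hb : b ∈ T)
    (hab : Ancestor parent a b) (hne : a ≠ b) :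
    ∃ d, IsChild g parent T a d ∧ Ancestor parent d b := by
  classical
  cases hn : Nat.find hab with
  | zero => exact absurd (by simpa [hn] using Nat.find_spec hab) hne
  | succ n =>
    have ha : a = parent (parent^[n] b) := by
      simpa only [hn, Function.iterate_succ_apply'] using Nat.find_spec hab
    refine ⟨parent^[n] b, ⟨hT.iterate_mem hb n, fun hg => ?_, ha.symm⟩, n, rfl⟩
    have hlt : n < Nat.find hab := by omega
    exact Nat.find_min hab hlt (by rw [ha, hg, hpg])

lemma card_voters_le_wt {B V : Type*} [DecidableEq B] [DecidableEq V] {parent : B → B}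
    (W : Finset (V × B)) {a b : B} (hab : Ancestor parent a b) :
    ((W.filter (fun q => q.2 = b)).image Prod.fst).card ≤ wt parent W a := by
  classical
  rw [wt]
  refine Finset.card_le_card fun v hv => ?_
  simp only [Finset.mem_image, Finset.mem_filter] at hv ⊢
  obtain ⟨q, ⟨hq, rfl⟩, rfl⟩ := hv
  exact ⟨q, ⟨hq, hab⟩, rfl⟩

/-- The voters for `b` and the supporters of a block that is not an ancestor of `b` overlap only
in equivocators. -/
lemma card_voters_add_wt_le {B V : Type*} [DecidableEq B] [DecidableEq V] {parent : B → B}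
    {E : Finset V} {W : Finset (V × B)} (hWE : ∀ q ∈ W, q.1 ∈ E) {b c : B}
    (hcb : ¬ Ancestor parent c b) :
    ((W.filter (fun q => q.2 = b)).image Prod.fst).card + wt parent W c ≤
      E.card + (Equivocators W).card := by
  classical
  have hwt : wt parent W c =
      ((W.filter (fun q => Ancestor parent c q.2)).image Prod.fst).card := by
    unfold wt; congr!
  rw [hwt, ← Finset.card_union_add_card_inter]
  refine add_le_add (Finset.card_le_card fun v hv => ?_) (Finset.card_le_card fun v hv => ?_)
  · simp only [Finset.mem_union, Finset.mem_image, Finset.mem_filter] at hv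
    rcases hv with ⟨q, ⟨hq, -⟩, rfl⟩ | ⟨q, ⟨hq, -⟩, rfl⟩ <;> exact hWE q hq
  · simp only [Finset.mem_inter, Finset.mem_image, Finset.mem_filter] at hv
    obtain ⟨⟨⟨v, x⟩, ⟨hq, rfl⟩, rfl⟩, ⟨⟨w, y⟩, ⟨hr, hy⟩, rfl⟩⟩ := hv
    simp only [Equivocators, Finset.mem_filter, Finset.mem_image]
    exact ⟨⟨_, hq, rfl⟩, x, y, hq, hr, fun h => hcb (h ▸ hy)⟩

/-- **Fast-confirmation counting, vanilla version.** If all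
validators of `W` lie in a committee `E` with `|E| ≤ (1+ε)M`, at least
`(3/4+ε)M` distinct validators vote for `b` in `W`, and fewer than `M/2`
validators equivocate in `W`, then every block conflicting with `b` has weight
less than `(3/4)M`, and hence every greedy heaviest chain of `(T, W)` for any
blocktree finset `T` containing `b` contains `b`. -/
theorem fast_confirmation_vanilla
    {B V : Type*} [DecidableEq B] [DecidableEq V]
    (g : B) (parent : B → B) (hpg : parent g = g) (hanc : ∀ x, Ancestor parent g x)
    (ε M : ℝ) (hε : 0 < ε) (hM : 0 < M)
    (E : Finset V) (hE : (E.card : ℝ) ≤ (1 + ε) * M)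
    (W : Finset (V × B)) (hWE : ∀ q ∈ W, q.1 ∈ E)
    (b : B)
    (hvotes : (3 / 4 + ε) * M ≤ (((W.filter (fun q => q.2 = b)).image Prod.fst).card : ℝ))
    (hequiv : ((Equivocators W).card : ℝ) < (1 / 2) * M) :
    (∀ c, Conflicting parent b c → (wt parent W c : ℝ) < (3 / 4) * M) ∧
      ∀ T : Finset B, IsBlocktree g parent T → b ∈ T →
        ∀ k ch, IsGreedyChain g parent T W k ch → ∃ i ≤ k, ch i = b := by
  have hlight : ∀ c, ¬ Ancestor parent c b → (wt parent W c : ℝ) < (3 / 4) * M := by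
    intro c hc
    have h : (_ : ℝ) ≤ _ := Nat.cast_le.mpr (card_voters_add_wt_le hWE hc)
    push_cast at h
    linarith
  refine ⟨fun c hc => hlight c hc.2, fun T hT hb k ch ⟨h0, _, hstep, hend⟩ => ?_⟩
  by_contra! hne
  have hch : ∀ i ≤ k, Ancestor parent (ch i) b := by
    intro i
    induction i with
    | zero => exact fun _ => h0 ▸ hanc b
    | succ i ih =>
      intro hi
      obtain ⟨d, hd, hdb⟩ :=
        hT.exists_isChild_ancestor hpg hb (ih (by omega)) (hne i (by omega))
      by_contra hnot
      have hlt := hlight _ hnot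
      have hle : (_ : ℝ) ≤ _ :=
        Nat.cast_le.mpr ((card_voters_le_wt W hdb).trans ((hstep i hi).2 d hd))
      nlinarith [mul_pos hε hM]
  obtain ⟨d, hd, -⟩ := hT.exists_isChild_ancestor hpg hb (hch k le_rfl) (hne k le_rfl)
  exact hend d hd
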